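/- arXiv:2404.03978 — 5 statements merged into one kernel-verified Lean document; each statement's English description precedes it below -/
import Mathlib

section
/- Let N ≥ 2. The expected squared Euclidean norm of the random vector V(σ) under a uniformly random permutation σ of {1,...,N} equals N²(N+1)/12; that is, (1/N!) · Σ_{σ ∈ S_N} ‖Σ_{j=1}^{N} σ(j) · (cos(2πj/N), sin(2πj/N))‖² = N²(N+1)/12. -/
open Real

/-- The RVG output as a vector in the Euclidean plane:
V(σ) = Σ_{j=1}^{N} σ(j) · (cos(2πj/N), sin(2πj/N)), with {1,...,N} encoded via `Fin N`. -/
noncomputable def RVG (N : ℕ) (σ : Equiv.Perm (Fin N)) : EuclideanSpace ℝ (Fin 2) :=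
  ∑ j : Fin N, ((σ j : ℝ) + 1) •
    (WithLp.equiv 2 (Fin 2 → ℝ)).symm
      ![Real.cos (2 * Real.pi * ((j : ℝ) + 1) / N), Real.sin (2 * Real.pi * ((j : ℝ) + 1) / N)]

theorem exists_perm_pair {N : ℕ} {i j i' j' : Fin N} (h : i ≠ j) (h' : i' ≠ j') :
    ∃ τ : Equiv.Perm (Fin N), τ i = i' ∧ τ j = j' := by
  refine ⟨Equiv.swap (Equiv.swap i i' j) j' * Equiv.swap i i', ?_, ?_⟩
  · rw [Equiv.Perm.mul_apply, Equiv.swap_apply_left]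
    apply Equiv.swap_apply_of_ne_of_ne _ h'
    intro e
    apply h
    apply (Equiv.swap i i').injective
    rw [Equiv.swap_apply_left]; exact e
  · rw [Equiv.Perm.mul_apply, Equiv.swap_apply_left]

theorem perm_moment_invariant {N : ℕ} (x : Fin N → ℝ) (i j : Fin N) (τ : Equiv.Perm (Fin N)) :
    ∑ σ : Equiv.Perm (Fin N), x (σ (τ i)) * x (σ (τ j)) =
      ∑ σ : Equiv.Perm (Fin N), x (σ i) * x (σ j) :=
  Fintype.sum_equiv (Equiv.mulRight τ) _ _ (fun σ => by simp)

theorem exists_perm_moments {N : ℕ} (hN : 2 ≤ N) (x : Fin N → ℝ) :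
    ∃ A B : ℝ, ∀ i j : Fin N,
      ∑ σ : Equiv.Perm (Fin N), x (σ i) * x (σ j) = B + if i = j then A - B else 0 := by
  let p : Fin N := ⟨0, by omega⟩
  let q : Fin N := ⟨1, by omega⟩
  have hpq : p ≠ q := by simp [p, q]
  refine ⟨∑ σ : Equiv.Perm (Fin N), x (σ p) * x (σ p),
    ∑ σ : Equiv.Perm (Fin N), x (σ p) * x (σ q), fun i j => ?_⟩
  split_ifs with h
  · subst h
    have := perm_moment_invariant x p p (Equiv.swap p i)
    rw [Equiv.swap_apply_left] at this
    rw [this]; ring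
  · obtain ⟨τ, h1, h2⟩ := exists_perm_pair hpq h
    have := perm_moment_invariant x p q τ
    rw [h1, h2] at this
    rw [this]; ring

theorem sq_sum_eq {N : ℕ} (x a : Fin N → ℝ) (A B : ℝ)
    (hAB : ∀ i j : Fin N,
      ∑ σ : Equiv.Perm (Fin N), x (σ i) * x (σ j) = B + if i = j then A - B else 0) :
    ∑ σ : Equiv.Perm (Fin N), (∑ j, x (σ j) * a j) ^ 2 =
      B * (∑ j, a j) ^ 2 + (A - B) * ∑ j, a j ^ 2 := by
  have h1 : ∀ σ : Equiv.Perm (Fin N), (∑ j, x (σ j) * a j) ^ 2 =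
      ∑ i, ∑ j, (x (σ i) * x (σ j)) * (a i * a j) := by
    intro σ
    rw [sq, Finset.sum_mul_sum]
    exact Finset.sum_congr rfl fun i _ => Finset.sum_congr rfl fun j _ => by ring
  simp_rw [h1]
  rw [Finset.sum_comm]
  have h2 : ∀ i : Fin N, ∑ σ : Equiv.Perm (Fin N), ∑ j, (x (σ i) * x (σ j)) * (a i * a j) =
      ∑ j, B * (a i * a j) + (A - B) * a i ^ 2 := by
    intro i
    rw [Finset.sum_comm]
    simp_rw [← Finset.sum_mul, hAB, add_mul, Finset.sum_add_distrib]
    congr 1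
    simp only [ite_mul, zero_mul, Finset.sum_ite_eq, Finset.mem_univ, if_true]
    ring
  simp_rw [h2, Finset.sum_add_distrib, ← Finset.mul_sum]
  rw [sq (∑ j, a j), Finset.sum_mul_sum]
  simp_rw [← Finset.mul_sum]

theorem sum_angles {N : ℕ} (hN : 2 ≤ N) :
    (∑ j : Fin N, Real.cos (2 * Real.pi * ((j : ℝ) + 1) / N)) = 0 ∧
    (∑ j : Fin N, Real.sin (2 * Real.pi * ((j : ℝ) + 1) / N)) = 0 := by
  have hz := (Complex.isPrimitiveRoot_exp N (by omega)).geom_sum_eq_zero (by omega)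
  have key : ∑ j : Fin N, Complex.exp (((2 * Real.pi * ((j : ℝ) + 1) / N : ℝ) : ℂ) * Complex.I)
      = 0 := by
    rw [← Fin.sum_univ_eq_sum_range (fun i => Complex.exp (2 * Real.pi * Complex.I / N) ^ i)] at hz
    rw [← mul_zero (Complex.exp (2 * Real.pi * Complex.I / N)), ← hz, Finset.mul_sum]
    refine Finset.sum_congr rfl fun j _ => ?_
    rw [← pow_succ', ← Complex.exp_nat_mul]
    congr 1
    push_cast
    ring
  constructor
  · have := congrArg Complex.re key
    simpa only [Complex.re_sum, Complex.exp_ofReal_mul_I_re, Complex.zero_re] using this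
  · have := congrArg Complex.im key
    simpa only [Complex.im_sum, Complex.exp_ofReal_mul_I_im, Complex.zero_im] using this

theorem sum_labels (N : ℕ) :
    (∑ j : Fin N, ((j : ℝ) + 1)) = (N : ℝ) * (N + 1) / 2 ∧
    (∑ j : Fin N, ((j : ℝ) + 1) ^ 2) = (N : ℝ) * (N + 1) * (2 * N + 1) / 6 := by
  rw [Fin.sum_univ_eq_sum_range (fun j : ℕ => (j : ℝ) + 1),
    Fin.sum_univ_eq_sum_range (fun j : ℕ => ((j : ℝ) + 1) ^ 2)]
  induction N with
  | zero => simp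
  | succ n ih =>
    rw [Finset.sum_range_succ, Finset.sum_range_succ, ih.1, ih.2]
    push_cast
    constructor <;> ring

theorem norm_RVG_sq (N : ℕ) (σ : Equiv.Perm (Fin N)) :
    ‖RVG N σ‖ ^ 2 =
      (∑ j : Fin N, ((σ j : ℝ) + 1) * Real.cos (2 * Real.pi * ((j : ℝ) + 1) / N)) ^ 2 +
      (∑ j : Fin N, ((σ j : ℝ) + 1) * Real.sin (2 * Real.pi * ((j : ℝ) + 1) / N)) ^ 2 := by
  rw [EuclideanSpace.norm_sq_eq, Fin.sum_univ_two]
  simp [RVG]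

/-- For N ≥ 2, the expected squared Euclidean norm of V(σ) under a uniformly random
permutation σ of {1,...,N} equals N²(N+1)/12. -/
theorem expected_sq_norm_RVG (N : ℕ) (hN : 2 ≤ N) :
    (1 / (N.factorial : ℝ)) * ∑ σ : Equiv.Perm (Fin N), ‖RVG N σ‖ ^ 2 =
      (N : ℝ) ^ 2 * ((N : ℝ) + 1) / 12 := by
  obtain ⟨hc, hs⟩ := sum_angles hN
  obtain ⟨l1, l2⟩ := sum_labels N
  let x : Fin N → ℝ := fun j => (j : ℝ) + 1
  obtain ⟨A, B, hAB⟩ := exists_perm_moments hN x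
  have hcos := sq_sum_eq x (fun j : Fin N => Real.cos (2 * Real.pi * ((j : ℝ) + 1) / N)) A B hAB
  have hsin := sq_sum_eq x (fun j : Fin N => Real.sin (2 * Real.pi * ((j : ℝ) + 1) / N)) A B hAB
  have hone := sq_sum_eq x (fun _ => 1) A B hAB
  have hperm : ∀ σ : Equiv.Perm (Fin N), ∑ j, x (σ j) * 1 = N * (N + 1) / 2 := by
    intro σ
    simp_rw [mul_one]
    rw [Equiv.sum_comp σ x]; exact l1
  simp_rw [hperm] at hone
  simp [Fintype.card_perm] at hone
  -- diagonal moments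
  have hdiag : (N : ℝ) * A = N.factorial * (N * (N + 1) * (2 * N + 1) / 6) := by
    have h1 : ∑ i : Fin N, ∑ σ : Equiv.Perm (Fin N), x (σ i) * x (σ i) = N * A := by
      simp_rw [hAB]; simp
    rw [← h1, Finset.sum_comm]
    have h2 : ∀ σ : Equiv.Perm (Fin N), ∑ i, x (σ i) * x (σ i) =
        N * (N + 1) * (2 * N + 1) / 6 := by
      intro σ
      rw [Equiv.sum_comp σ (fun i => x i * x i), ← l2]
      exact Finset.sum_congr rfl fun i _ => by simp only [x]; ring
    simp_rw [h2]
    simp [Fintype.card_perm]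
  have hsq : (∑ j : Fin N, Real.cos (2 * Real.pi * ((j : ℝ) + 1) / N) ^ 2) +
      (∑ j : Fin N, Real.sin (2 * Real.pi * ((j : ℝ) + 1) / N) ^ 2) = N := by
    rw [← Finset.sum_add_distrib]; simp
  have htot : ∑ σ : Equiv.Perm (Fin N), ‖RVG N σ‖ ^ 2 = (A - B) * N := by
    simp_rw [norm_RVG_sq]
    rw [Finset.sum_add_distrib]
    simp only [x, hc, hs] at hcos hsin
    rw [hcos, hsin]
    linear_combination (A - B) * hsq
  have hN2 : (2 : ℝ) ≤ N := by exact_mod_cast hN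
  have hf : (N.factorial : ℝ) ≠ 0 := by exact_mod_cast N.factorial_ne_zero
  have hAmB : A - B = N.factorial * (N * (N + 1) / 12) := by
    have hne : (N : ℝ) * (N - 1) ≠ 0 := mul_ne_zero (by linarith) (by linarith)
    apply mul_left_cancel₀ hne
    linear_combination hone + (N : ℝ) * hdiag
  rw [htot, hAmB]
  field_simp
end

section
/- For every integer N ≥ 1, F(N) = ⌊e · N!⌋, where F(N) = Σ_{j=0}^{N} N!/(N−j)! and e is Euler's number. -/
/-- P(n,i) = n!/(n−i)!, the number of i-permutations of n (the division is exact for i ≤ n). -/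
def P (n i : ℕ) : ℕ := n.factorial / (n - i).factorial

/-- F(N) = Σ_{j=0}^{N} P(N,j), the total number of permutation events over N elements. -/
def F (N : ℕ) : ℕ := ∑ j ∈ Finset.range (N + 1), P N j

theorem F_cast_aux (N : ℕ) :
    (F N : ℝ) = (∑ m ∈ Finset.range (N + 1), (1 : ℝ) ^ m / (m.factorial : ℝ)) * N.factorial := by
  rw [← Finset.sum_range_reflect, Finset.sum_mul, F, Nat.cast_sum]
  refine Finset.sum_congr rfl fun j _ => ?_
  have h : N + 1 - 1 - j = N - j := by omega
  have hd : (N - j).factorial ∣ N.factorial := Nat.factorial_dvd_factorial (Nat.sub_le N j)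
  rw [h, P, Nat.cast_div hd (by positivity), one_pow]
  ring

/-- For every integer N ≥ 1, F(N) = ⌊e · N!⌋. -/
theorem F_eq_floor_e_mul_factorial (N : ℕ) (hN : 1 ≤ N) :
    F N = ⌊Real.exp 1 * (N.factorial : ℝ)⌋₊ := by
  symm
  have hf : (0 : ℝ) < N.factorial := by positivity
  have hN' : (1 : ℝ) ≤ N := by exact_mod_cast hN
  rw [Nat.floor_eq_iff (by positivity), F_cast_aux]
  constructor
  · exact mul_le_mul_of_nonneg_right (Real.sum_le_exp_of_nonneg zero_le_one _) hf.le
  · have h := Real.exp_bound' (x := 1) zero_le_one le_rfl (Nat.succ_pos N)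
    have h2 := mul_le_mul_of_nonneg_right h hf.le
    refine lt_of_le_of_lt h2 ?_
    rw [add_mul]
    refine add_lt_add_of_le_of_lt le_rfl ?_
    rw [Nat.succ_eq_add_one, Nat.factorial_succ, one_pow, div_mul_eq_mul_div,
      div_lt_one (by positivity)]
    push_cast
    nlinarith [mul_pos hf (by positivity : (0 : ℝ) < N), mul_le_mul_of_nonneg_left hN' hf.le,
      mul_le_mul_of_nonneg_left hN' (mul_nonneg hf.le (by positivity : (0 : ℝ) ≤ N))]
end

section
/- Define the permutation distribution P_Per(n|N) = P(N,n) / (F(N) − 1) for 1 ≤ n ≤ N. Then for every fixed integer k ≥ 0, lim_{N→∞} P_Per(N−k | N) = 1/(e · k!). -/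
/-- The permutation distribution: P_Per(n|N) = P(N,n) / (F(N) − 1). -/
noncomputable def P_Per (n N : ℕ) : ℝ := (P N n : ℝ) / ((F N - 1 : ℕ) : ℝ)

lemma P_cast (N i : ℕ) : (P N i : ℝ) = (N.factorial : ℝ) / ((N - i).factorial : ℝ) := by
  unfold P
  rw [Nat.cast_div (Nat.factorial_dvd_factorial (Nat.sub_le N i))]
  exact_mod_cast Nat.factorial_ne_zero _

lemma F_cast (N : ℕ) : (F N : ℝ) =
    (N.factorial : ℝ) * ∑ j ∈ Finset.range (N + 1), 1 / (j.factorial : ℝ) := by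
  unfold F
  rw [Nat.cast_sum, ← Finset.sum_range_reflect, Finset.mul_sum]
  refine Finset.sum_congr rfl fun j hj => ?_
  have hj' := Finset.mem_range.mp hj
  rw [P_cast, show N - (N + 1 - 1 - j) = j by omega]
  ring

lemma one_le_F (N : ℕ) : 1 ≤ F N := by
  unfold F
  calc 1 = P N 0 := by simp [P, Nat.div_self (Nat.factorial_pos N)]
    _ ≤ _ := Finset.single_le_sum (f := fun j => P N j) (fun _ _ => Nat.zero_le _) (by simp)

/-- For every fixed integer k ≥ 0, lim_{N→∞} P_Per(N−k | N) = 1/(e · k!). -/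
theorem limit_P_Per (k : ℕ) :
    Filter.Tendsto (fun N : ℕ => P_Per (N - k) N) Filter.atTop
      (nhds (1 / (Real.exp 1 * (k.factorial : ℝ)))) := by
  have hexp : Filter.Tendsto (fun N : ℕ => ∑ j ∈ Finset.range (N + 1), 1 / (j.factorial : ℝ))
      Filter.atTop (nhds (Real.exp 1)) := by
    have h := (NormedSpace.expSeries_div_hasSum_exp (1 : ℝ)).tendsto_sum_nat
    rw [← Real.exp_eq_exp_ℝ] at h
    simp only [one_pow] at h
    exact h.comp (Filter.tendsto_add_atTop_nat 1)
  have hinv : Filter.Tendsto (fun N : ℕ => 1 / (N.factorial : ℝ)) Filter.atTop (nhds 0) := by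
    simpa using FloorSemiring.tendsto_pow_div_factorial_atTop (1 : ℝ)
  have hk : (k.factorial : ℝ) ≠ 0 := by exact_mod_cast Nat.factorial_ne_zero k
  have hlim := (tendsto_const_nhds (x := 1 / (k.factorial : ℝ))).div (hexp.sub hinv)
    (by simp [Real.exp_ne_zero])
  have he : 1 / (Real.exp 1 * (k.factorial : ℝ)) = 1 / (k.factorial : ℝ) / (Real.exp 1 - 0) := by
    rw [sub_zero, div_div, mul_comm]
  rw [he]
  refine hlim.congr' ?_
  filter_upwards [Filter.eventually_ge_atTop k] with N hN
  have hN0 : (N.factorial : ℝ) ≠ 0 := by exact_mod_cast Nat.factorial_ne_zero N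
  simp only [Pi.div_apply]
  unfold P_Per
  rw [Nat.cast_sub (one_le_F N), F_cast, P_cast, Nat.sub_sub_self hN, Nat.cast_one]
  rw [← mul_div_mul_left _ _ hN0, mul_sub, mul_one_div, mul_one_div, div_self hN0]
end

section
/- Let N ≥ 2 and t ≥ 1. The expected squared Euclidean norm of the RPST-generated random walk after t steps equals t · N²(N+1)/12; that is, (1/(N!)^t) · Σ_{(σ_1,...,σ_t) ∈ (S_N)^t} ‖Σ_{m=1}^{t} V(σ_m)‖² = t · N²(N+1)/12, where V(σ) = Σ_{j=1}^{N} σ(j) · (cos(2πj/N), sin(2πj/N)). In particular the variance of the walk grows linearly in the number of steps t. -/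
open Real

lemma aux_walk {P E : Type*} [Fintype P] [NormedAddCommGroup E] [InnerProductSpace ℝ E]
    (v : P → E) (hv : ∑ p, v p = 0) (t : ℕ) :
    (Fintype.card P : ℝ) * ∑ s : Fin t → P, ‖∑ m, v (s m)‖ ^ 2
      = t * (Fintype.card P : ℝ) ^ t * ∑ p, ‖v p‖ ^ 2 := by
  induction t with
  | zero => simp
  | succ t ih =>
    have h1 : ∑ s : Fin (t + 1) → P, ‖∑ m, v (s m)‖ ^ 2
        = ∑ x : P × (Fin t → P), ‖v x.1 + ∑ m, v (x.2 m)‖ ^ 2 := by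
      refine (Fintype.sum_equiv (Fin.consEquiv (fun _ : Fin (t + 1) => P)) _ _ ?_).symm
      intro x
      simp [Fin.sum_univ_succ, Fin.consEquiv]
    have h2 : ∑ x : P × (Fin t → P), inner ℝ (v x.1) (∑ m, v (x.2 m)) = 0 := by
      rw [Fintype.sum_prod_type_right]
      simp [← sum_inner, hv]
    have h3 : ∑ x : P × (Fin t → P), ‖v x.1 + ∑ m, v (x.2 m)‖ ^ 2
        = (Fintype.card P : ℝ) ^ t * ∑ p, ‖v p‖ ^ 2
          + Fintype.card P * ∑ s : Fin t → P, ‖∑ m, v (s m)‖ ^ 2 := by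
      simp_rw [norm_add_sq_real, Finset.sum_add_distrib, ← Finset.mul_sum, h2]
      rw [Fintype.sum_prod_type, Fintype.sum_prod_type]
      simp [Finset.mul_sum]
    rw [h1, h3, ih]
    push_cast
    ring

lemma aux_perm1 (N : ℕ) (f : Fin N → ℝ) (i : Fin N) :
    (N : ℝ) * ∑ σ : Equiv.Perm (Fin N), f (σ i) = N.factorial * ∑ k, f k := by
  have h : ∀ j, ∑ σ : Equiv.Perm (Fin N), f (σ j) = ∑ σ : Equiv.Perm (Fin N), f (σ i) := by
    intro j
    refine Fintype.sum_equiv (Equiv.mulRight (Equiv.swap i j)) _ _ ?_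
    intro σ
    simp
  have h2 : ∑ j, ∑ σ : Equiv.Perm (Fin N), f (σ j) = N.factorial * ∑ k, f k := by
    rw [Finset.sum_comm]
    simp_rw [Equiv.sum_comp]
    simp [Fintype.card_perm]
  rw [← h2, Finset.sum_congr rfl (fun j _ => h j)]
  simp

lemma aux_perm2 (N : ℕ) (a : Fin N → ℝ) (i j : Fin N) (hij : i ≠ j) :
    (N : ℝ) * ((N : ℝ) - 1) * ∑ σ : Equiv.Perm (Fin N), a (σ i) * a (σ j)
      = N.factorial * ((∑ k, a k) ^ 2 - ∑ k, a k ^ 2) := by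
  have h : ∀ k ∈ Finset.univ.erase i, ∑ σ : Equiv.Perm (Fin N), a (σ i) * a (σ k)
      = ∑ σ : Equiv.Perm (Fin N), a (σ i) * a (σ j) := by
    intro k hk
    have hk : k ≠ i := by simpa using hk
    refine Fintype.sum_equiv (Equiv.mulRight (Equiv.swap j k)) _ _ ?_
    intro σ
    simp [Equiv.swap_apply_of_ne_of_ne hij hk.symm]
  have h2 : ∑ k, ∑ σ : Equiv.Perm (Fin N), a (σ i) * a (σ k)
      = (∑ σ : Equiv.Perm (Fin N), a (σ i)) * ∑ k, a k := by
    rw [Finset.sum_comm]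
    simp_rw [← Finset.mul_sum, Equiv.sum_comp, Finset.sum_mul]
  rw [← Finset.add_sum_erase _ _ (Finset.mem_univ i), Finset.sum_congr rfl h] at h2
  have hN : 1 ≤ N := i.pos
  simp only [Finset.sum_const, Finset.card_erase_of_mem (Finset.mem_univ i), Finset.card_univ,
    Fintype.card_fin, nsmul_eq_mul, Nat.cast_sub hN, Nat.cast_one, ← sq] at h2
  have h3 := aux_perm1 N a i
  have h4 := aux_perm1 N (fun k => a k ^ 2) i
  linear_combination N * h2 + (∑ k, a k) * h3 - h4

lemma aux_var {E : Type*} [NormedAddCommGroup E] [InnerProductSpace ℝ E] (N : ℕ) (hN : 2 ≤ N)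
    (a : Fin N → ℝ) (e : Fin N → E) (he : ∀ j, ‖e j‖ = 1) (hs : ∑ j, e j = 0) :
    ((N : ℝ) - 1) * ∑ σ : Equiv.Perm (Fin N), ‖∑ j, a (σ j) • e j‖ ^ 2
      = N.factorial * (N * ∑ k, a k ^ 2 - (∑ k, a k) ^ 2) := by
  have hN0 : (N : ℝ) ≠ 0 := by positivity
  have key : ∀ i j, (N : ℝ) * ((N : ℝ) - 1) * ∑ σ : Equiv.Perm (Fin N), a (σ i) * a (σ j)
      = N.factorial * ((∑ k, a k) ^ 2 - ∑ k, a k ^ 2)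
        + if i = j then N.factorial * (N * ∑ k, a k ^ 2 - (∑ k, a k) ^ 2) else 0 := by
    intro i j
    split_ifs with h
    · subst h
      have h4 := aux_perm1 N (fun k => a k ^ 2) i
      simp only [← sq]
      linear_combination (N - 1 : ℝ) * h4
    · rw [aux_perm2 N a i j h, add_zero]
  have h0 : ∑ i, ∑ j, inner ℝ (e i) (e j) = 0 := by
    simp_rw [← inner_sum, hs]
    simp
  have h1 : ∑ σ : Equiv.Perm (Fin N), ‖∑ j, a (σ j) • e j‖ ^ 2
      = ∑ i, ∑ j, (∑ σ : Equiv.Perm (Fin N), a (σ i) * a (σ j)) * inner ℝ (e i) (e j) := by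
    simp_rw [← real_inner_self_eq_norm_sq, sum_inner, inner_sum, Finset.sum_mul]
    rw [Finset.sum_comm]
    refine Finset.sum_congr rfl fun i _ => ?_
    rw [Finset.sum_comm]
    refine Finset.sum_congr rfl fun j _ => Finset.sum_congr rfl fun σ _ => ?_
    rw [real_inner_smul_left, real_inner_smul_right]
    ring
  apply mul_left_cancel₀ hN0
  rw [h1, ← mul_assoc]
  simp_rw [Finset.mul_sum, ← mul_assoc, ← Finset.mul_sum, key, add_mul, Finset.sum_add_distrib,
    ← Finset.mul_sum, h0]
  simp [he]
  ring

lemma aux_sum_e (N : ℕ) (hN : 2 ≤ N) :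
    ∑ j : Fin N, (WithLp.equiv 2 (Fin 2 → ℝ)).symm
      ![Real.cos (2 * Real.pi * ((j : ℝ) + 1) / N), Real.sin (2 * Real.pi * ((j : ℝ) + 1) / N)]
      = 0 := by
  have hN0 : N ≠ 0 := by omega
  have hp := Complex.isPrimitiveRoot_exp N hN0
  have hg := hp.geom_sum_eq_zero (by omega)
  have h : ∑ j : Fin N, Complex.exp (((2 * Real.pi * ((j : ℝ) + 1) / N : ℝ) : ℂ) * Complex.I)
      = 0 := by
    have : ∀ j : Fin N, Complex.exp (((2 * Real.pi * ((j : ℝ) + 1) / N : ℝ) : ℂ) * Complex.I)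
        = Complex.exp (2 * Real.pi * Complex.I / N)
          * Complex.exp (2 * Real.pi * Complex.I / N) ^ (j : ℕ) := by
      intro j
      rw [← Complex.exp_nat_mul, ← Complex.exp_add]
      congr 1
      push_cast
      ring
    simp_rw [this]
    rw [← Finset.mul_sum, Fin.sum_univ_eq_sum_range
      (fun k => Complex.exp (2 * Real.pi * Complex.I / N) ^ k), hg, mul_zero]
  ext i
  fin_cases i
  · have := congrArg Complex.re h
    simp only [Complex.re_sum, Complex.exp_ofReal_mul_I_re] at this
    simp only [WithLp.ofLp_sum, Finset.sum_apply]
    exact this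
  · have := congrArg Complex.im h
    simp only [Complex.im_sum, Complex.exp_ofReal_mul_I_im] at this
    simp only [WithLp.ofLp_sum, Finset.sum_apply]
    exact this

lemma aux_S1 (N : ℕ) : ∑ k : Fin N, (((k : ℕ) : ℝ) + 1) = (N : ℝ) * (N + 1) / 2 := by
  rw [Fin.sum_univ_eq_sum_range (fun k : ℕ => (k : ℝ) + 1)]
  induction N with
  | zero => simp
  | succ n ih => rw [Finset.sum_range_succ, ih]; push_cast; ring

lemma aux_S2 (N : ℕ) : ∑ k : Fin N, (((k : ℕ) : ℝ) + 1) ^ 2 = (N : ℝ) * (N + 1) * (2 * N + 1) / 6 := by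
  rw [Fin.sum_univ_eq_sum_range (fun k : ℕ => ((k : ℝ) + 1) ^ 2)]
  induction N with
  | zero => simp
  | succ n ih => rw [Finset.sum_range_succ, ih]; push_cast; ring

lemma aux_RVG_sum (N : ℕ) (hN : 2 ≤ N) : ∑ σ : Equiv.Perm (Fin N), RVG N σ = 0 := by
  have hN0 : (N : ℝ) ≠ 0 := by positivity
  have h : ∀ j : Fin N, ∑ σ : Equiv.Perm (Fin N), ((σ j : ℝ) + 1)
      = N.factorial * (∑ k : Fin N, (((k : ℕ) : ℝ) + 1)) / N := by
    intro j
    rw [eq_div_iff hN0, mul_comm]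
    exact aux_perm1 N (fun k => (k : ℝ) + 1) j
  unfold RVG
  rw [Finset.sum_comm]
  simp_rw [← Finset.sum_smul, h]
  rw [← Finset.smul_sum, aux_sum_e N hN, smul_zero]

lemma aux_RVG_sq (N : ℕ) (hN : 2 ≤ N) : ∑ σ : Equiv.Perm (Fin N), ‖RVG N σ‖ ^ 2
    = N.factorial * ((N : ℝ) ^ 2 * ((N : ℝ) + 1) / 12) := by
  have h := aux_var N hN (fun k => (k : ℝ) + 1) (fun j => (WithLp.equiv 2 (Fin 2 → ℝ)).symm
      ![Real.cos (2 * Real.pi * ((j : ℝ) + 1) / N), Real.sin (2 * Real.pi * ((j : ℝ) + 1) / N)])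
      (fun j => by simp [EuclideanSpace.norm_eq]) (aux_sum_e N hN)
  have hN1 : (N : ℝ) - 1 ≠ 0 := by
    have : (2 : ℝ) ≤ N := by exact_mod_cast hN
    linarith
  apply mul_left_cancel₀ hN1
  simp only [aux_S1, aux_S2] at h
  unfold RVG
  rw [h]
  ring

/-- For N ≥ 2 and t ≥ 1, the expected squared Euclidean norm of the RPST-generated random
walk after t steps (averaging over all t-tuples of permutations with weight 1/(N!)^t)
equals t · N²(N+1)/12; in particular the variance of the walk grows linearly in t. -/
theorem expected_sq_norm_walk (N t : ℕ) (hN : 2 ≤ N) (ht : 1 ≤ t) :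
    (1 / ((N.factorial : ℝ)) ^ t) *
        ∑ σs : Fin t → Equiv.Perm (Fin N), ‖∑ m : Fin t, RVG N (σs m)‖ ^ 2 =
      (t : ℝ) * ((N : ℝ) ^ 2 * ((N : ℝ) + 1) / 12) := by

  have hw := aux_walk (RVG N) (aux_RVG_sum N hN) t
  rw [aux_RVG_sq N hN, Fintype.card_perm, Fintype.card_fin] at hw
  have hF : (N.factorial : ℝ) ≠ 0 := by positivity
  have h2 : ∑ σs : Fin t → Equiv.Perm (Fin N), ‖∑ m : Fin t, RVG N (σs m)‖ ^ 2
      = (t : ℝ) * (N.factorial : ℝ) ^ t * ((N : ℝ) ^ 2 * ((N : ℝ) + 1) / 12) := by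
    apply mul_left_cancel₀ hF
    rw [hw]
    ring
  rw [h2]
  field_simp
end

section
/- With V_x(σ) = Σ_{j=1}^{N} σ(j)·cos(2πj/N), the rescaled per-step component variance of the RPST-generated random walk converges to 1: lim_{N→∞} (24/N³) · (1/N!) · Σ_{σ ∈ S_N} V_x(σ)² = 1. Hence scaling each step by √ϱ/(N√N) with variance control factor ϱ = 24 normalizes the step's component variance to 1 in the limit. -/
open Real

/-- The x-component of the RVG output: V_x(σ) = Σ_{j=1}^{N} σ(j)·cos(2πj/N),
with {1,...,N} encoded via `Fin N`. -/
noncomputable def Vx (N : ℕ) (σ : Equiv.Perm (Fin N)) : ℝ :=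
  ∑ j : Fin N, ((σ j : ℝ) + 1) * Real.cos (2 * Real.pi * ((j : ℝ) + 1) / N)

lemma cos_tele (t : ℝ) (n : ℕ) :
    2 * Real.sin (t/2) * ∑ j ∈ Finset.range n, Real.cos (t * ((j:ℝ)+1))
      = Real.sin (t * n + t/2) - Real.sin (t/2) := by
  induction n with
  | zero => simp
  | succ n ih =>
    rw [Finset.sum_range_succ, mul_add, ih]
    have h1 : t * (n:ℝ) + t/2 = t * ((n:ℝ)+1) - t/2 := by ring
    push_cast
    rw [h1, Real.sin_sub, Real.sin_add]
    ring

lemma cos_sum_zero (N k : ℕ) (hk : 0 < k) (hkN : k < N) :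
    ∑ j : Fin N, Real.cos ((2 * Real.pi * k / N) * ((j:ℝ)+1)) = 0 := by
  have hN : (0:ℝ) < N := by exact_mod_cast (hk.trans hkN)
  have hk' : (0:ℝ) < k := by exact_mod_cast hk
  have hkN' : (k:ℝ) < N := by exact_mod_cast hkN
  rw [Fin.sum_univ_eq_sum_range (fun j : ℕ => Real.cos ((2 * Real.pi * k / N) * ((j:ℝ)+1)))]
  have h := cos_tele (2 * Real.pi * k / N) N
  have e : 2 * Real.pi * k / N * N + 2 * Real.pi * k / N / 2
      = 2 * Real.pi * k / N / 2 + k * (2 * Real.pi) := by field_simp; ring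
  rw [e, Real.sin_add_nat_mul_two_pi, sub_self] at h
  have hs : 0 < Real.sin (2 * Real.pi * k / N / 2) := by
    apply Real.sin_pos_of_pos_of_lt_pi
    · have := Real.pi_pos
      positivity
    · have e2 : 2 * Real.pi * k / N / 2 = Real.pi * (k / N) := by ring
      rw [e2]
      have : (k:ℝ)/N < 1 := by rw [div_lt_one hN]; exact hkN'
      nlinarith [Real.pi_pos]
  rcases mul_eq_zero.mp h with h | h
  · linarith
  · exact h

lemma cos_sum (N : ℕ) (hN : 3 ≤ N) :
    ∑ j : Fin N, Real.cos (2 * Real.pi * ((j : ℝ) + 1) / N) = 0 := by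
  rw [← cos_sum_zero N 1 (by norm_num) (by omega)]
  refine Finset.sum_congr rfl fun j _ => ?_
  congr 1
  push_cast
  ring

lemma cos_sq_sum (N : ℕ) (hN : 3 ≤ N) :
    ∑ j : Fin N, Real.cos (2 * Real.pi * ((j : ℝ) + 1) / N) ^ 2 = N / 2 := by
  have h := cos_sum_zero N 2 (by norm_num) (by omega)
  have h2 : ∀ j : Fin N, Real.cos (2 * Real.pi * ((j : ℝ) + 1) / N) ^ 2
      = 1/2 + Real.cos ((2 * Real.pi * (2:ℕ) / N) * ((j:ℝ)+1)) / 2 := by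
    intro j
    rw [Real.cos_sq]
    congr 3
    push_cast
    ring
  simp_rw [h2]
  rw [Finset.sum_add_distrib, ← Finset.sum_div Finset.univ (fun j : Fin N => Real.cos ((2 * Real.pi * (2:ℕ) / N) * ((j:ℝ)+1))), h]
  simp
  try ring

lemma perm_moment (N : ℕ) (hN : 2 ≤ N) (a c : Fin N → ℝ) (hc : ∑ j, c j = 0) :
    (N:ℝ) * (N - 1) * ∑ σ : Equiv.Perm (Fin N), (∑ j, a (σ j) * c j) ^ 2
      = N.factorial * (N * ∑ j, a j ^ 2 - (∑ j, a j) ^ 2) * ∑ j, c j ^ 2 := by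
  set E : Fin N → Fin N → ℝ := fun i j => ∑ σ : Equiv.Perm (Fin N), a (σ i) * a (σ j) with hE
  have inv : ∀ (τ : Equiv.Perm (Fin N)) i j, E (τ i) (τ j) = E i j := by
    intro τ i j
    exact Fintype.sum_equiv (Equiv.mulRight τ) _ _ (fun σ => rfl)
  let z : Fin N := ⟨0, by omega⟩
  let o : Fin N := ⟨1, by omega⟩
  have hzo : z ≠ o := by simp [z, o]
  have hA : ∀ i, E i i = E z z := by
    intro i
    have := inv (Equiv.swap z i) z z
    rwa [Equiv.swap_apply_left] at this
  have hB : ∀ i j, i ≠ j → E i j = E z o := by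
    intro i j hij
    obtain ⟨τ, h1, h2⟩ := (MulAction.is_two_pretransitive_iff (G := Equiv.Perm (Fin N)) (α := Fin N)).mp
      (Equiv.Perm.isMultiplyPretransitive (Fin N) 2) hzo hij
    rw [← inv τ z o]
    simp only [Equiv.Perm.smul_def] at h1 h2
    rw [h1, h2]
  have hEE : ∀ i j, E i j = E z o + (if i = j then E z z - E z o else 0) := by
    intro i j
    split_ifs with h
    · subst h; rw [hA]; ring
    · rw [hB i j h]; ring
  have s1 : (N:ℝ) * E z z = N.factorial * ∑ j, a j ^ 2 := by
    have : ∑ i, E i i = N.factorial * ∑ j, a j ^ 2 := by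
      simp only [hE]
      rw [Finset.sum_comm]
      have : ∀ σ : Equiv.Perm (Fin N), ∑ i, a (σ i) * a (σ i) = ∑ j, a j ^ 2 := by
        intro σ
        rw [← Equiv.sum_comp σ (fun j => a j ^ 2)]
        simp [sq]
      simp [this, Fintype.card_perm]
    rw [← this]
    simp [hA]
  have sq_exp : ∀ (f : Fin N → ℝ), (∑ j, f j) ^ 2 = ∑ i, ∑ j, f i * f j := by
    intro f; rw [sq, Finset.sum_mul_sum]
  have quad : ∀ d : Fin N → ℝ, ∑ σ : Equiv.Perm (Fin N), (∑ j, a (σ j) * d j) ^ 2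
      = E z o * (∑ j, d j) ^ 2 + (E z z - E z o) * ∑ j, d j ^ 2 := by
    intro d
    have : ∑ σ : Equiv.Perm (Fin N), (∑ j, a (σ j) * d j) ^ 2
        = ∑ i, ∑ j, E i j * (d i * d j) := by
      simp_rw [sq_exp]
      rw [Finset.sum_comm]
      refine Finset.sum_congr rfl fun i _ => ?_
      rw [Finset.sum_comm]
      refine Finset.sum_congr rfl fun j _ => ?_
      simp only [hE]
      rw [Finset.sum_mul]
      exact Finset.sum_congr rfl fun σ _ => by ring
    rw [this, sq_exp]
    simp_rw [fun i j => congrArg (· * (d i * d j)) (hEE i j), add_mul, Finset.sum_add_distrib, ite_mul, zero_mul]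
    simp [Finset.mul_sum, sq]
  have s2 := quad (fun _ => 1)
  have : ∀ σ : Equiv.Perm (Fin N), ∑ i, a (σ i) = ∑ j, a j := fun σ => Equiv.sum_comp σ a
  simp [this, Fintype.card_perm] at s2
  rw [quad c, hc]
  linear_combination (∑ j, c j ^ 2) * (N * s1 + s2)

lemma sum_id (N : ℕ) : ∑ j : Fin N, ((j:ℝ)+1) = (N:ℝ) * (N+1) / 2 := by
  rw [Fin.sum_univ_eq_sum_range (fun j : ℕ => ((j:ℝ)+1))]
  induction N with
  | zero => simp
  | succ n ih => rw [Finset.sum_range_succ, ih]; push_cast; ring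

lemma sum_id_sq (N : ℕ) : ∑ j : Fin N, ((j:ℝ)+1)^(2:ℕ) = (N:ℝ) * (N+1) * (2*N+1) / 6 := by
  rw [Fin.sum_univ_eq_sum_range (fun j : ℕ => ((j:ℝ)+1)^(2:ℕ))]
  induction N with
  | zero => simp
  | succ n ih => rw [Finset.sum_range_succ, ih]; push_cast; ring

/-- The rescaled per-step component variance of the RPST-generated random walk converges
to 1: lim_{N→∞} (24/N³) · (1/N!) · Σ_{σ ∈ S_N} V_x(σ)² = 1, so scaling each step by
√ϱ/(N√N) with ϱ = 24 normalizes the step's component variance to 1 in the limit. -/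
theorem rescaled_component_variance_tendsto_one :
    Filter.Tendsto
      (fun N : ℕ =>
        (24 / (N : ℝ) ^ 3) *
          ((1 / (N.factorial : ℝ)) * ∑ σ : Equiv.Perm (Fin N), Vx N σ ^ 2))
      Filter.atTop (nhds 1) := by
  have lim : Filter.Tendsto (fun N : ℕ => 1 + 1 / (N:ℝ)) Filter.atTop (nhds 1) := by
    simpa using (tendsto_one_div_atTop_nhds_zero_nat (𝕜 := ℝ)).const_add 1
  refine lim.congr' ?_
  filter_upwards [Filter.eventually_ge_atTop 3] with N hN
  have h := perm_moment N (by omega) (fun j => (j:ℝ)+1)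
    (fun j => Real.cos (2 * Real.pi * ((j : ℝ) + 1) / N)) (cos_sum N hN)
  rw [cos_sq_sum N hN, sum_id, sum_id_sq] at h
  change (N:ℝ) * (N - 1) * ∑ σ : Equiv.Perm (Fin N), Vx N σ ^ 2 = _ at h
  have hN' : (3:ℝ) ≤ N := by exact_mod_cast hN
  have h0 : (N:ℝ) ≠ 0 := by linarith
  have h1 : (N:ℝ) - 1 ≠ 0 := by linarith
  have hf : (N.factorial : ℝ) ≠ 0 := by exact_mod_cast N.factorial_ne_zero
  have hS : ∑ σ : Equiv.Perm (Fin N), Vx N σ ^ 2 = N.factorial * (N^2 * (N+1) / 24) := by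
    apply mul_left_cancel₀ (mul_ne_zero h0 h1)
    rw [h]
    ring
  rw [hS]
  field_simp
end
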